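/- Let E, F be Banach spaces with F ↪ E continuously and densely, and let K : D(K) ⊂ F → E generate a strongly continuous semigroup when arranged as the reduction matrix 𝐊 = [[0, I_F],[K, 0]] on F × E with domain D(K) × F. If J : [D(K)] → F is bounded (for the graph norm of K), then the perturbed matrix [[0, I_F],[K+J, 0]] with the same domain also generates a strongly continuous semigroup on F × E. -/

import Mathlib

open Set

theorem isUnit_one_sub_mul_swap {A : Type*} [Ring A] {a b : A} (h : IsUnit (1 - a * b)) :
    IsUnit (1 - b * a) := by
  have := not_congr (spectrum.unit_mem_mul_comm (R := ℤ) (a := a) (b := b) (r := 1))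
  simp only [spectrum.mem_iff, not_not, Units.val_one, map_one] at this
  exact this.1 h

/-- A strongly continuous one-parameter semigroup of bounded operators, indexed by `t ≥ 0`
(the values of `T` at negative times are irrelevant). -/
structure IsC0Semigroup {X : Type*} [NormedAddCommGroup X] [NormedSpace ℝ X]
    (T : ℝ → X →L[ℝ] X) : Prop where
  zero : T 0 = 1
  add : ∀ t s : ℝ, 0 ≤ t → 0 ≤ s → T (t + s) = T t ∘L T s
  cont : ∀ x : X, ContinuousOn (fun t => T t x) (Ici 0)

namespace IsC0Semigroup

open Filter Topology MeasureTheory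
open scoped BoundedContinuousFunction

variable {X : Type*} [NormedAddCommGroup X] [NormedSpace ℝ X]

/-- `x` lies in the domain of the generator of `T`, and the generator maps `x` to `d`. -/
def GenAt (T : ℝ → X →L[ℝ] X) (x d : X) : Prop :=
  HasDerivWithinAt (fun t => T t x) d (Ici 0) 0

theorem GenAt.unique {T : ℝ → X →L[ℝ] X} {x d e : X} (hd : GenAt T x d) (he : GenAt T x e) :
    d = e :=
  (uniqueDiffOn_Ici (0 : ℝ) 0 self_mem_Ici).eq_deriv _ hd he

/-- The semigroup `t ↦ exp (c t) T(t)`. -/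
noncomputable def expScale (c : ℝ) (T : ℝ → X →L[ℝ] X) (t : ℝ) : X →L[ℝ] X :=
  Real.exp (c * t) • T t

theorem expScale_neg_expScale (c : ℝ) (T : ℝ → X →L[ℝ] X) : expScale (-c) (expScale c T) = T := by
  funext t
  simp [expScale, smul_smul, ← Real.exp_add]

variable {T : ℝ → X →L[ℝ] X}

protected theorem rescale (hT : IsC0Semigroup T) (c : ℝ) : IsC0Semigroup (expScale c T) where
  zero := by simp [expScale, hT.zero]
  add t s ht hs := by
    ext x
    simp [expScale, hT.add t s ht hs, mul_add, Real.exp_add, smul_smul, mul_comm]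
  cont x := by
    have h := hT.cont x
    simp only [expScale, smul_apply]
    fun_prop

theorem GenAt.rescale (hT : T 0 = 1) {x d : X} (h : GenAt T x d) (c : ℝ) :
    GenAt (expScale c T) x (d + c • x) := by
  have he : HasDerivWithinAt (fun t : ℝ => Real.exp (c * t)) c (Ici 0) 0 := by
    simpa using ((hasDerivAt_id (0 : ℝ)).const_mul c).exp.hasDerivWithinAt (s := Ici 0)
  have h1 := he.smul h
  simp only [mul_zero, Real.exp_zero, one_smul, hT, one_apply_eq_self] at h1
  exact h1

theorem genAt_expScale_iff (hT : T 0 = 1) {x d : X} (c : ℝ) :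
    GenAt (expScale c T) x d ↔ GenAt T x (d - c • x) := by
  refine ⟨fun h => ?_, fun h => by simpa using h.rescale hT c⟩
  have := h.rescale (by simp [expScale, hT]) (-c)
  rw [expScale_neg_expScale] at this
  simpa [sub_eq_add_neg] using this

theorem exists_norm_le_exp [CompleteSpace X] (hT : IsC0Semigroup T) :
    ∃ M ω : ℝ, 0 < M ∧ ∀ t, 0 ≤ t → ‖T t‖ ≤ M * Real.exp (ω * t) := by
  obtain ⟨C, hC⟩ : ∃ C, ∀ t : Icc (0 : ℝ) 1, ‖T t‖ ≤ C := by
    refine banach_steinhaus fun x => ?_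
    obtain ⟨C, hC⟩ := isCompact_Icc.exists_bound_of_continuousOn
      ((hT.cont x).mono (Icc_subset_Ici_self : Icc (0 : ℝ) 1 ⊆ Ici 0))
    exact ⟨C, fun t => hC t t.2⟩
  set M := max C 1
  have hM1 : 1 ≤ M := le_max_right _ _
  have hM : 0 < M := by linarith
  have hb : ∀ t, 0 ≤ t → t ≤ 1 → ‖T t‖ ≤ M := fun t h0 h1 =>
    (hC ⟨t, h0, h1⟩).trans (le_max_left _ _)
  refine ⟨M, Real.log M, hM, ?_⟩
  have key : ∀ n : ℕ, ∀ t : ℝ, 0 ≤ t → t ≤ n + 1 → ‖T t‖ ≤ M * Real.exp (Real.log M * t) := by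
    intro n
    induction n with
    | zero =>
      intro t h0 h1
      refine (hb t h0 (by simpa using h1)).trans (le_mul_of_one_le_right hM.le ?_)
      exact Real.one_le_exp (mul_nonneg (Real.log_nonneg hM1) h0)
    | succ n ih =>
      intro t h0 h1
      rcases le_total t 1 with h | h
      · exact ih t h0 (h.trans (by simp))
      · have h2 := ih (t - 1) (by linarith) (by push_cast at h1; linarith)
        have h3 : T t = T 1 ∘L T (t - 1) := by
          rw [← hT.add 1 (t - 1) zero_le_one (by linarith)]; congr 1; ring
        calc ‖T t‖ ≤ ‖T 1‖ * ‖T (t - 1)‖ := by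
              rw [h3]; exact ContinuousLinearMap.opNorm_comp_le _ _
          _ ≤ M * (M * Real.exp (Real.log M * (t - 1))) := by
              gcongr; exact hb 1 zero_le_one le_rfl
          _ = M * Real.exp (Real.log M * t) := by
              rw [mul_sub, mul_one, Real.exp_sub, Real.exp_log hM]; field_simp
  intro t ht
  exact key ⌈t⌉₊ t ht ((Nat.le_ceil t).trans (by linarith))

theorem norm_expScale_le {M ω : ℝ} (h : ∀ t, 0 ≤ t → ‖T t‖ ≤ M * Real.exp (ω * t)) (c : ℝ) :
    ∀ t, 0 ≤ t → ‖expScale c T t‖ ≤ M * Real.exp ((ω + c) * t) := by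
  intro t ht
  rw [expScale, norm_smul, Real.norm_eq_abs, abs_of_pos (Real.exp_pos _), add_mul, Real.exp_add]
  calc _ ≤ Real.exp (c * t) * (M * Real.exp (ω * t)) := by gcongr; exact h t ht
    _ = _ := by ring

theorem continuous_apply_max [CompleteSpace X] (hT : IsC0Semigroup T) :
    Continuous fun p : ℝ × X => T (max p.1 0) p.2 := by
  obtain ⟨M, ω, -, hM⟩ := hT.exists_norm_le_exp
  have hs : ∀ x, Continuous fun t : ℝ => T (max t 0) x := fun x =>
    (hT.cont x).comp_continuous (by fun_prop) fun t => mem_Ici.2 (le_max_right _ _)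
  refine continuous_iff_continuousAt.2 fun ⟨t₀, x₀⟩ => ?_
  have h1 : Tendsto (fun p : ℝ × X => M * Real.exp (ω * max p.1 0) * ‖p.2 - x₀‖
      + ‖T (max p.1 0) x₀ - T (max t₀ 0) x₀‖) (𝓝 (t₀, x₀)) (𝓝 0) := by
    have hc : Continuous fun p : ℝ × X => M * Real.exp (ω * max p.1 0) * ‖p.2 - x₀‖
      + ‖T (max p.1 0) x₀ - T (max t₀ 0) x₀‖ := by
      exact (by fun_prop : Continuous fun p : ℝ × X => M * Real.exp (ω * max p.1 0) * ‖p.2 - x₀‖).add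
        (((hs x₀).comp continuous_fst).sub continuous_const).norm
    simpa using hc.tendsto (t₀, x₀)
  refine tendsto_iff_norm_sub_tendsto_zero.2
    (squeeze_zero (fun _ => norm_nonneg _) (fun p => ?_) h1)
  calc ‖T (max p.1 0) p.2 - T (max t₀ 0) x₀‖
      = ‖T (max p.1 0) (p.2 - x₀) + (T (max p.1 0) x₀ - T (max t₀ 0) x₀)‖ := by
        rw [map_sub]; congr 1; abel
    _ ≤ _ := (norm_add_le _ _).trans (by
        gcongr; exact (T _).le_of_opNorm_le (hM _ (le_max_right _ _)) _)

section Decay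

variable {M δ : ℝ}

theorem integrableOn_orbit (hT : IsC0Semigroup T) (hδ : 0 < δ)
    (hM : ∀ t, 0 ≤ t → ‖T t‖ ≤ M * Real.exp (-δ * t)) (x : X) :
    IntegrableOn (fun t => T t x) (Ioi 0) := by
  refine Integrable.mono' (((integrableOn_exp_mul_Ioi (neg_neg_of_pos hδ) 0).const_mul M).mul_const
    ‖x‖) (((hT.cont x).mono Ioi_subset_Ici_self).aestronglyMeasurable measurableSet_Ioi) ?_
  filter_upwards [self_mem_ae_restrict measurableSet_Ioi] with t ht
  exact (T t).le_of_opNorm_le (hM t (le_of_lt ht)) x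

theorem exists_inverse_generator [CompleteSpace X] (hT : IsC0Semigroup T) (hδ : 0 < δ)
    (hM : ∀ t, 0 ≤ t → ‖T t‖ ≤ M * Real.exp (-δ * t)) :
    ∃ R : X →L[ℝ] X, ‖R‖ ≤ M / δ ∧ ∀ x d, GenAt T x d ↔ x = R (-d) := by
  have hint := hT.integrableOn_orbit hδ hM
  have hM0 : 0 ≤ M := by simpa using (norm_nonneg _).trans (hM 0 le_rfl)
  let R : X →L[ℝ] X := LinearMap.mkContinuous
    { toFun := fun x => ∫ t in Ioi (0 : ℝ), T t x
      map_add' := fun x y => by simp only [map_add]; exact integral_add (hint x) (hint y)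
      map_smul' := fun c x => by simp only [map_smul]; exact integral_smul _ _ }
    (M / δ) (fun x => by
      refine (norm_integral_le_of_norm_le
        (((integrableOn_exp_mul_Ioi (neg_neg_of_pos hδ) 0).const_mul M).mul_const ‖x‖) ?_).trans_eq ?_
      · filter_upwards [self_mem_ae_restrict measurableSet_Ioi] with t ht
        exact (T t).le_of_opNorm_le (hM t (le_of_lt ht)) x
      · rw [integral_mul_const, integral_const_mul, integral_exp_mul_Ioi (neg_neg_of_pos hδ)]
        simp [div_eq_mul_inv])
  have hR : ∀ x, R x = ∫ t in Ioi (0 : ℝ), T t x := fun x => rfl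
  have hcomm : ∀ h, 0 ≤ h → ∀ x, T h (R x) = R (T h x) := fun h hh x => by
    rw [hR, hR, ← ContinuousLinearMap.integral_comp_comm _ (hint x)]
    refine setIntegral_congr_fun measurableSet_Ioi fun t ht => ?_
    have ht : 0 ≤ t := le_of_lt ht
    change (T h ∘L T t) x = (T t ∘L T h) x
    rw [← hT.add h t hh ht, ← hT.add t h ht hh, add_comm]
  have hshift : ∀ h, 0 ≤ h → ∀ x, T h (R x) = R x - ∫ t in (0 : ℝ)..h, T t x := fun h hh x => by
    have h1 := intervalIntegral.integral_Ioi_sub_Ioi (hint x) hh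
    rw [← h1, hcomm h hh, hR, hR, sub_sub_cancel]
    rw [← (measurePreserving_add_right volume h).setIntegral_preimage_emb
      (measurableEmbedding_addRight h) (fun t => T t x) (Ioi h)]
    have : (fun t => t + h) ⁻¹' Ioi h = Ioi 0 := by ext; simp
    rw [this]
    refine setIntegral_congr_fun measurableSet_Ioi fun t ht => ?_
    simp [hT.add t h (le_of_lt ht) hh]
  have hgen : ∀ x, GenAt T (R x) (-x) := fun x => by
    have hcont : Continuous fun t : ℝ => T (max t 0) x :=
      hT.continuous_apply_max.comp (by fun_prop : Continuous fun t : ℝ => (t, x))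
    have h1 := (hcont.integral_hasStrictDerivAt 0 0).hasDerivAt.hasDerivWithinAt (s := Ici 0)
    have h2 := h1.const_sub (R x)
    simp only [max_self, hT.zero, one_apply_eq_self] at h2
    refine h2.congr_of_mem (fun h hh => ?_) self_mem_Ici
    rw [hshift h hh]
    congr 1
    refine intervalIntegral.integral_congr fun t ht => ?_
    rw [uIcc_of_le hh] at ht
    simp [ht.1]
  refine ⟨R, LinearMap.mkContinuous_norm_le _ (by positivity) _, fun x d => ⟨fun h => ?_, ?_⟩⟩
  · have h1 : HasDerivWithinAt (fun t => R (T t x)) (R d) (Ici 0) 0 :=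
      R.hasFDerivAt.comp_hasDerivWithinAt 0 h
    have h2 : GenAt T (R x) (R d) := h1.congr_of_mem (fun t ht => hcomm t ht x) self_mem_Ici
    rw [map_neg, h2.unique (hgen x), neg_neg]
  · rintro rfl
    simpa using hgen (-d)

end Decay

theorem exists_resolvent [CompleteSpace X] (hT : IsC0Semigroup T) {ε : ℝ} (hε : 0 < ε) :
    ∃ (l : ℝ) (R : X →L[ℝ] X), ‖R‖ < ε ∧ ∀ x d, GenAt T x d ↔ x = R (l • x - d) := by
  obtain ⟨M, ω, hM0, hM⟩ := hT.exists_norm_le_exp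
  have hδ : 0 < 2 * M / ε := by positivity
  obtain ⟨R, hR, h⟩ := (hT.rescale (-(ω + 2 * M / ε))).exists_inverse_generator hδ
    (M := M) (by simpa using norm_expScale_le hM (-(ω + 2 * M / ε)))
  refine ⟨ω + 2 * M / ε, R, hR.trans_lt ?_, fun x d => ?_⟩
  · field_simp; linarith
  · rw [← neg_sub, ← h, genAt_expScale_iff hT.zero, neg_smul, sub_neg_eq_add,
      sub_add_cancel]

/-- The convolution `t ↦ ∫₀ᵗ T(s) C f(t - s) ds`, extended by zero to negative times. -/
noncomputable def duhamel (T : ℝ → X →L[ℝ] X) (C : X →L[ℝ] X) (f : ℝ → X) (t : ℝ) : X :=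
  ∫ s in (0 : ℝ)..max t 0, T (max s 0) (C (f (max t 0 - s)))

section Duhamel

variable {M δ : ℝ}

theorem duhamel_zero (C : X →L[ℝ] X) (f : ℝ → X) : duhamel T C f 0 = 0 := by
  simp [duhamel]

theorem norm_duhamel_le (hδ : 0 < δ) (hM : ∀ t, 0 ≤ t → ‖T t‖ ≤ M * Real.exp (-δ * t))
    (C : X →L[ℝ] X) {f : ℝ → X} {c : ℝ} (hc : ∀ t, ‖f t‖ ≤ c) (t : ℝ) :
    ‖duhamel T C f t‖ ≤ M / δ * ‖C‖ * c := by
  have hM0 : 0 ≤ M := by simpa using (norm_nonneg _).trans (hM 0 le_rfl)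
  have hc0 : 0 ≤ c := (norm_nonneg _).trans (hc 0)
  have hexp := integrableOn_exp_mul_Ioi (neg_neg_of_pos hδ) 0
  calc ‖duhamel T C f t‖
      ≤ ∫ s in (0 : ℝ)..max t 0, M * Real.exp (-δ * s) * (‖C‖ * c) := by
        refine intervalIntegral.norm_integral_le_of_norm_le (le_max_right _ _)
          (Eventually.of_forall fun s hs => ?_) (Continuous.intervalIntegrable (by fun_prop) _ _)
        rw [max_eq_left hs.1.le]
        exact (T s).le_of_opNorm_le_of_le (hM s hs.1.le) (C.le_opNorm_of_le (hc _))
    _ = M * (∫ s in Ioc (0 : ℝ) (max t 0), Real.exp (-δ * s)) * (‖C‖ * c) := by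
        rw [intervalIntegral.integral_mul_const, intervalIntegral.integral_const_mul,
          intervalIntegral.integral_of_le (le_max_right _ _)]
    _ ≤ M * (∫ s in Ioi (0 : ℝ), Real.exp (-δ * s)) * (‖C‖ * c) := by
        refine mul_le_mul_of_nonneg_right (mul_le_mul_of_nonneg_left ?_ hM0) (by positivity)
        exact setIntegral_mono_set hexp (Eventually.of_forall fun s => (Real.exp_pos _).le)
          Ioc_subset_Ioi_self.eventuallyLE
    _ = M / δ * ‖C‖ * c := by
        rw [integral_exp_mul_Ioi (neg_neg_of_pos hδ)]
        simp [div_eq_mul_inv, mul_assoc]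

variable [CompleteSpace X]

theorem continuous_duhamel_kernel (hT : IsC0Semigroup T) (C : X →L[ℝ] X) {f : ℝ → X}
    (hf : Continuous f) : Continuous fun p : ℝ × ℝ => T (max p.2 0) (C (f (max p.1 0 - p.2))) :=
  hT.continuous_apply_max.comp
    (by fun_prop : Continuous fun p : ℝ × ℝ => (p.2, C (f (max p.1 0 - p.2))))

theorem continuous_duhamel_integrand (hT : IsC0Semigroup T) (C : X →L[ℝ] X) {f : ℝ → X}
    (hf : Continuous f) (t : ℝ) : Continuous fun s : ℝ => T (max s 0) (C (f (t - s))) :=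
  hT.continuous_apply_max.comp (by fun_prop : Continuous fun s : ℝ => (s, C (f (t - s))))

theorem continuous_duhamel (hT : IsC0Semigroup T) (C : X →L[ℝ] X) {f : ℝ → X}
    (hf : Continuous f) : Continuous (duhamel T C f) :=
  intervalIntegral.continuous_parametric_intervalIntegral_of_continuous
    (hT.continuous_duhamel_kernel C hf) (by fun_prop)

theorem hasDerivWithinAt_duhamel (hT : IsC0Semigroup T) (C : X →L[ℝ] X) {f : ℝ → X}
    (hf : Continuous f) : HasDerivWithinAt (duhamel T C f) (C (f 0)) (Ici 0) 0 := by
  rw [hasDerivWithinAt_iff_isLittleO, Asymptotics.isLittleO_iff]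
  intro ε hε
  obtain ⟨r, hr, h⟩ := Metric.continuousAt_iff.1
    ((hT.continuous_duhamel_kernel C hf).continuousAt (x := (0, 0))) ε hε
  filter_upwards [self_mem_nhdsWithin, mem_nhdsWithin_of_mem_nhds (Metric.ball_mem_nhds 0 hr)]
    with t ht htr
  have ht0 : 0 ≤ t := ht
  rw [duhamel_zero, sub_zero, sub_zero, duhamel, max_eq_left ht0]
  have h1 : t • C (f 0) = ∫ s in (0 : ℝ)..t, C (f 0) := by simp
  rw [h1, ← intervalIntegral.integral_sub
    ((hT.continuous_duhamel_integrand C hf t).intervalIntegrable _ _) (by simp)]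
  have h2 := intervalIntegral.norm_integral_le_of_norm_le_const (a := 0) (b := t) (C := ε)
    (f := fun s => T (max s 0) (C (f (t - s))) - C (f 0)) fun s hs => by
      rw [uIoc_of_le ht0] at hs
      have htr' : t < r := by simpa [abs_of_nonneg ht0] using htr
      have h3 := h (x := (t, s)) (by
        simp only [Prod.dist_eq, Real.dist_eq, sub_zero, abs_of_nonneg ht0, abs_of_pos hs.1]
        exact max_lt htr' (hs.2.trans_lt htr'))
      simpa [dist_eq_norm, hT.zero, max_eq_left ht0] using h3.le
  simpa using h2

/-- Cocycle property of the convolution under time shifts. -/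
theorem duhamel_add (hT : IsC0Semigroup T) (C : X →L[ℝ] X) {f : ℝ → X} (hf : Continuous f)
    {t h : ℝ} (ht : 0 ≤ t) (hh : 0 ≤ h) :
    duhamel T C f (t + h) =
      T t (duhamel T C f h) + duhamel T C (fun r => f (max r 0 + h)) t := by
  have hc := hT.continuous_duhamel_integrand C hf (t + h)
  simp only [duhamel, max_eq_left ht, max_eq_left hh, max_eq_left (add_nonneg ht hh)]
  rw [← intervalIntegral.integral_add_adjacent_intervals (hc.intervalIntegrable 0 t)
    (hc.intervalIntegrable t (t + h)), add_comm]
  congr 1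
  · rw [← ContinuousLinearMap.intervalIntegral_comp_comm _
      ((hT.continuous_duhamel_integrand C hf h).intervalIntegrable _ _)]
    have := intervalIntegral.integral_comp_add_left (a := 0) (b := h)
      (fun s => T (max s 0) (C (f (t + h - s)))) t
    rw [add_zero] at this
    rw [← this]
    refine intervalIntegral.integral_congr fun s hs => ?_
    rw [uIcc_of_le hh] at hs
    simp only [max_eq_left hs.1, max_eq_left (add_nonneg ht hs.1), hT.add t s ht hs.1,
      add_sub_add_left_eq_sub, ContinuousLinearMap.comp_apply]
  · refine intervalIntegral.integral_congr fun s hs => ?_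
    rw [uIcc_of_le ht] at hs
    simp only [max_eq_left (sub_nonneg.2 hs.2)]
    congr 4
    ring

theorem exists_bounded_perturbation_of_decay (hT : IsC0Semigroup T) (hδ : 0 < δ)
    (hM : ∀ t, 0 ≤ t → ‖T t‖ ≤ M * Real.exp (-δ * t)) (C : X →L[ℝ] X) (hC : M / δ * ‖C‖ < 1) :
    ∃ S : ℝ → X →L[ℝ] X, IsC0Semigroup S ∧ ∀ x d, GenAt S x d ↔ GenAt T x (d - C x) := by
  have hM0 : 0 ≤ M := by simpa using (norm_nonneg _).trans (hM 0 le_rfl)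
  let V : (ℝ →ᵇ X) →L[ℝ] (ℝ →ᵇ X) := LinearMap.mkContinuous
    { toFun := fun f => BoundedContinuousFunction.ofNormedAddCommGroup (duhamel T C f)
        (hT.continuous_duhamel C f.continuous) _ (norm_duhamel_le hδ hM C f.norm_coe_le_norm)
      map_add' := fun f g => by
        ext t
        simp only [BoundedContinuousFunction.coe_ofNormedAddCommGroup, duhamel,
          BoundedContinuousFunction.coe_add, Pi.add_apply, map_add]
        exact intervalIntegral.integral_add
          ((hT.continuous_duhamel_integrand C f.continuous _).intervalIntegrable _ _)
          ((hT.continuous_duhamel_integrand C g.continuous _).intervalIntegrable _ _)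
      map_smul' := fun c f => by
        ext t
        simp [duhamel] }
    (M / δ * ‖C‖) (fun f => BoundedContinuousFunction.norm_ofNormedAddCommGroup_le _
      (by positivity) (norm_duhamel_le hδ hM C f.norm_coe_le_norm))
  have hV : ‖V‖ < 1 := (LinearMap.mkContinuous_norm_le _ (by positivity) _).trans_lt hC
  have hbound : ∀ x t, ‖T (max t 0) x‖ ≤ M * ‖x‖ := fun x t =>
    (T _).le_of_opNorm_le ((hM _ (le_max_right _ _)).trans (mul_le_of_le_one_right hM0
      (Real.exp_le_one_iff.2 (by nlinarith [le_max_right t 0])))) x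
  have horb : ∀ x, Continuous fun t : ℝ => T (max t 0) x := fun x =>
    hT.continuous_apply_max.comp (by fun_prop : Continuous fun t : ℝ => (t, x))
  let O : X →L[ℝ] (ℝ →ᵇ X) := LinearMap.mkContinuous
    { toFun := fun x => BoundedContinuousFunction.ofNormedAddCommGroup _ (horb x) _ (hbound x)
      map_add' := fun x y => by ext t; simp
      map_smul' := fun c x => by ext t; simp }
    M (fun x => BoundedContinuousFunction.norm_ofNormedAddCommGroup_le _ (by positivity) (hbound x))
  let W := Units.oneSub V hV
  let U : X →L[ℝ] (ℝ →ᵇ X) := (↑W⁻¹ : (ℝ →ᵇ X) →L[ℝ] (ℝ →ᵇ X)) ∘L O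
  have hU : ∀ x f, f = U x ↔ ∀ t, f t = T (max t 0) x + duhamel T C f t := by
    intro x f
    have h1 : f = U x ↔ (W : (ℝ →ᵇ X) →L[ℝ] (ℝ →ᵇ X)) f = O x := by
      constructor
      · rintro rfl
        change ((W : (ℝ →ᵇ X) →L[ℝ] (ℝ →ᵇ X)) * ↑W⁻¹) (O x) = O x
        simp
      · intro h
        change f = (↑W⁻¹ : (ℝ →ᵇ X) →L[ℝ] (ℝ →ᵇ X)) (O x)
        rw [← h]
        change f = ((↑W⁻¹ : (ℝ →ᵇ X) →L[ℝ] (ℝ →ᵇ X)) * ↑W) f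
        simp
    rw [h1, DFunLike.ext_iff]
    refine forall_congr' fun t => ?_
    change f t - duhamel T C f t = T (max t 0) x ↔ _
    exact sub_eq_iff_eq_add
  have hUe : ∀ x t, 0 ≤ t → U x t = T t x + duhamel T C (U x) t := fun x t ht => by
    simpa [max_eq_left ht] using (hU x (U x)).1 rfl t
  have hU0 : ∀ x, U x 0 = x := fun x => by
    simpa [duhamel_zero, hT.zero] using hUe x 0 le_rfl
  refine ⟨fun t => (BoundedContinuousFunction.evalCLM ℝ t) ∘L U, ⟨?_, ?_, ?_⟩, ?_⟩
  · ext x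
    exact hU0 x
  · intro t h ht hh
    ext x
    change U x (t + h) = U (U x h) t
    let g : ℝ →ᵇ X := (U x).compContinuous ⟨fun r => max r 0 + h, by fun_prop⟩
    have hg : g = U (U x h) := by
      refine (hU _ _).2 fun r => ?_
      change U x (max r 0 + h) = _
      rw [hUe x _ (add_nonneg (le_max_right _ _) hh), hUe x h hh,
        hT.duhamel_add C (U x).continuous (le_max_right _ _) hh, hT.add _ _ (le_max_right _ _) hh,
        map_add, add_assoc]
      simp only [duhamel, max_eq_left (le_max_right r 0)]
      rfl
    rw [← hg]
    simp [g, max_eq_left ht]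
  · exact fun x => (U x).continuous.continuousOn
  · intro x d
    have hD := hT.hasDerivWithinAt_duhamel C (U x).continuous
    rw [hU0] at hD
    constructor
    · intro h
      refine (HasDerivWithinAt.fun_sub h hD).congr_of_mem (fun t ht => ?_) self_mem_Ici
      exact eq_sub_of_add_eq (hUe x t ht).symm
    · intro h
      have h1 := HasDerivWithinAt.fun_add h hD
      rw [sub_add_cancel] at h1
      exact h1.congr_of_mem (fun t ht => hUe x t ht) self_mem_Ici

end Duhamel

theorem exists_bounded_perturbation [CompleteSpace X] (hT : IsC0Semigroup T) (C : X →L[ℝ] X) :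
    ∃ S : ℝ → X →L[ℝ] X, IsC0Semigroup S ∧ ∀ x d, GenAt S x d ↔ GenAt T x (d - C x) := by
  obtain ⟨M, ω, hM0, hM⟩ := hT.exists_norm_le_exp
  have hδ : 0 < M * (‖C‖ + 1) := by positivity
  set c := ω + M * (‖C‖ + 1)
  obtain ⟨S, hS, h⟩ := (hT.rescale (-c)).exists_bounded_perturbation_of_decay hδ
    (M := M) (by simpa [c] using norm_expScale_le hM (-c)) C (by field_simp; linarith)
  refine ⟨expScale c S, hS.rescale c, fun x d => ?_⟩
  rw [genAt_expScale_iff hS.zero, h, genAt_expScale_iff hT.zero]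
  congr! 1
  rw [neg_smul]
  abel

/-- **Bounded-on-the-domain perturbation theorem.** Let `R = (l - A)⁻¹` be a resolvent of the
generator `A` of `T`. If `B R = R C` with `C` bounded on `X`, that is, if `B` is bounded on the
domain of `A` for the graph norm, then `A + B` generates a strongly continuous semigroup. -/
theorem exists_perturbation_of_intertwining [CompleteSpace X] (hT : IsC0Semigroup T) {l : ℝ}
    {R C : X →L[ℝ] X} {B : X → X} (hR : ∀ x d, GenAt T x d ↔ x = R (l • x - d))
    (hB : ∀ y, B (R y) = R (C y)) :
    ∃ S : ℝ → X →L[ℝ] X, IsC0Semigroup S ∧ ∀ x d, GenAt S x d ↔ GenAt T x (d - B x) := by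
  obtain ⟨m, Q, hQ, hQT⟩ := hT.exists_resolvent (ε := 1 / (‖C‖ + 1)) (by positivity)
  have hCQ : ‖C * Q‖ < 1 := by
    rw [lt_div_iff₀ (by positivity)] at hQ
    refine (norm_mul_le C Q).trans_lt ?_
    nlinarith [norm_nonneg Q]
  -- the resolvent identity, `Q = R P = P R`
  set P : X →L[ℝ] X := 1 + (l - m) • Q with hP
  have hgen : ∀ y, GenAt T (Q y) (m • Q y - y) := fun y => (hQT _ _).2 (by simp)
  have hgenR : ∀ y, GenAt T (R y) (l • R y - y) := fun y => (hR _ _).2 (by simp)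
  have hRP : R * P = Q := by
    ext y
    have := (hR _ _).1 (hgen y)
    rw [mul_apply_eq_comp, this]
    congr 1
    simp [hP, sub_smul]
    abel
  have hQ2 : ∀ y, R y = Q (y + (m - l) • R y) := fun y => by
    have := (hQT _ _).1 (hgenR y)
    rw [this]
    congr 1
    rw [← this, sub_smul]
    abel
  have hPR : P * R = Q := by
    ext y
    have := hQ2 y
    rw [map_add, map_smul] at this
    simp only [hP, mul_apply_eq_comp, add_apply, smul_apply, one_apply_eq_self]
    nth_rw 1 [this]
    rw [sub_smul, sub_smul]
    abel
  set C' : X →L[ℝ] X := C * P + (m - l) • (R * C * P) with hC'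
  have hQC : Q * C' = R * (C * P) := by
    ext y
    simpa [hC'] using (hQ2 (C (P y))).symm
  obtain ⟨U, hU⟩ : IsUnit (1 - R * (C * P)) := by
    refine isUnit_one_sub_mul_swap ?_
    rw [mul_assoc, hPR]
    exact isUnit_one_sub_of_norm_lt_one hCQ
  have hUB : ∀ y, (U : X →L[ℝ] X) y = y - B (Q y) := fun y => by
    rw [hU, ← hRP, mul_apply_eq_comp, hB]; rfl
  have hUC : ∀ y, (U : X →L[ℝ] X) y = y - Q (C' y) := fun y => by
    rw [hU, ← hQC]; rfl
  have hUi : ∀ y, (U : X →L[ℝ] X) ((↑U⁻¹ : X →L[ℝ] X) y) = y := fun y => by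
    rw [← mul_apply_eq_comp]; simp
  have hiU : ∀ y, (↑U⁻¹ : X →L[ℝ] X) ((U : X →L[ℝ] X) y) = y := fun y => by
    rw [← mul_apply_eq_comp]; simp
  obtain ⟨S, hS, hST⟩ := hT.exists_bounded_perturbation C'
  refine ⟨fun t => (U : X →L[ℝ] X) * S t * (↑U⁻¹ : X →L[ℝ] X), ⟨?_, ?_, ?_⟩, ?_⟩
  · simp [hS.zero]
  · intro t s ht hs
    ext x
    simp [hS.add t s ht hs, hiU]
  · exact fun x => (U : X →L[ℝ] X).continuous.comp_continuousOn (hS.cont _)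
  · intro x d
    obtain ⟨y, rfl⟩ : ∃ y, (U : X →L[ℝ] X) y = x := ⟨_, hUi x⟩
    obtain ⟨e, rfl⟩ : ∃ e, (U : X →L[ℝ] X) e = d := ⟨_, hUi d⟩
    have h1 : GenAt (fun t => (U : X →L[ℝ] X) * S t * (↑U⁻¹ : X →L[ℝ] X)) ((U : X →L[ℝ] X) y) ((U : X →L[ℝ] X) e)
        ↔ GenAt S y e := by
      constructor
      · intro h
        have := (↑U⁻¹ : X →L[ℝ] X).hasFDerivAt.comp_hasDerivWithinAt (0 : ℝ) h
        simpa [GenAt, Function.comp_def, hiU] using this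
      · intro h
        have := (U : X →L[ℝ] X).hasFDerivAt.comp_hasDerivWithinAt (0 : ℝ) h
        simpa [GenAt, Function.comp_def, hiU] using this
    have h2 : GenAt S y e ↔ (U : X →L[ℝ] X) y = Q (m • y - e) := by
      rw [hST, hQT, hUC, sub_eq_iff_eq_add, ← map_add]
      congr! 2
      abel
    rw [h1, h2, hQT]
    constructor
    · intro h
      have h3 := hUB (m • y - e)
      rw [← h, map_sub, map_smul] at h3
      rw [← sub_add, h3, sub_add_cancel]
      exact h
    · intro h
      set w := m • (U : X →L[ℝ] X) y - ((U : X →L[ℝ] X) e - B ((U : X →L[ℝ] X) y)) with hw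
      have h3 : (U : X →L[ℝ] X) w = (U : X →L[ℝ] X) (m • y - e) := by
        rw [hUB, ← h, hw, map_sub, map_smul]
        abel
      rw [h, ← hiU w, h3, hiU]

end IsC0Semigroup

/-- Perturbation lemma (Lemma 2.5 of the paper): if the reduction matrix
𝐊 = [[0, I_F],[K, 0]] with domain D(K) × F generates a strongly continuous semigroup
on F × E, and J : [D(K)] → F is bounded for the graph norm, then the perturbed matrix
[[0, I_F],[K+J, 0]] with the same domain also generates a strongly continuous
semigroup on F × E. -/
theorem reduction_matrix_perturbation
    {E F : Type*}
    [NormedAddCommGroup E] [NormedSpace ℝ E] [CompleteSpace E]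
    [NormedAddCommGroup F] [NormedSpace ℝ F] [CompleteSpace F]
    -- continuous dense embedding F ↪ E
    (i : F →L[ℝ] E) (hi : Function.Injective i) (hdense : DenseRange i)
    -- the domain D(K) ⊂ F and the closed operator K : D(K) → E
    (DK : Submodule ℝ F) (hDK : Dense (DK : Set F))
    (K : DK →ₗ[ℝ] E)
    -- T is a strongly continuous semigroup on F × E …
    (T : ℝ → (F × E) →L[ℝ] (F × E))
    (hT0 : T 0 = 1)
    (hTadd : ∀ t s : ℝ, 0 ≤ t → 0 ≤ s → T (t + s) = T t ∘L T s)
    (hTcont : ∀ p : F × E, ContinuousOn (fun t => T t p) (Ici 0))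
    -- … generated by 𝐊(u,v) = (v, Ku), with domain D(K) × F :
    (hgen : ∀ (u : DK) (v : F),
      HasDerivWithinAt (fun t => T t ((u : F), i v)) ((v : F), K u) (Ici 0) 0)
    (hmax : ∀ (p d : F × E), HasDerivWithinAt (fun t => T t p) d (Ici 0) 0 →
      ∃ (u : DK) (v : F), p = ((u : F), i v))
    -- J : [D(K)] → F is bounded for the graph norm of K
    (J : DK →ₗ[ℝ] F)
    (hJ : ∃ M : ℝ, ∀ u : DK, ‖J u‖ ≤ M * (‖i (u : F)‖ + ‖K u‖)) :
    -- then [[0, I_F],[K+J, 0]] with domain D(K) × F generates a strongly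
    -- continuous semigroup on F × E
    ∃ S : ℝ → (F × E) →L[ℝ] (F × E),
      S 0 = 1 ∧
      (∀ t s : ℝ, 0 ≤ t → 0 ≤ s → S (t + s) = S t ∘L S s) ∧
      (∀ p : F × E, ContinuousOn (fun t => S t p) (Ici 0)) ∧
      (∀ (u : DK) (v : F),
        HasDerivWithinAt (fun t => S t ((u : F), i v))
          ((v : F), K u + i (J u)) (Ici 0) 0) ∧
      (∀ (p d : F × E), HasDerivWithinAt (fun t => S t p) d (Ici 0) 0 →
        ∃ (u : DK) (v : F), p = ((u : F), i v)) := by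
  have hT : IsC0Semigroup T := ⟨hT0, hTadd, hTcont⟩
  obtain ⟨M, hM⟩ := hJ
  obtain ⟨l, R, -, hR⟩ := hT.exists_resolvent one_pos
  have hRgen : ∀ y, IsC0Semigroup.GenAt T (R y) (l • R y - y) := fun y => (hR _ _).2 (by simp)
  have hmem : ∀ y, (R y).1 ∈ DK := fun y => by
    obtain ⟨u, v, h⟩ := hmax _ _ (hRgen y)
    simp [h]
  -- the first component of the resolvent, as a map into `D(K)`
  let r : (F × E) →ₗ[ℝ] DK := (LinearMap.fst ℝ F E ∘ₗ R.toLinearMap).codRestrict DK hmem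
  have hKr : ∀ y, K (r y) = l • (R y).2 - y.2 := fun y => by
    obtain ⟨u, v, h⟩ := hmax _ _ (hRgen y)
    have hu : r y = u := Subtype.ext (congrArg Prod.fst h)
    have h1 := hgen u v
    rw [← h] at h1
    rw [hu]
    exact congrArg Prod.snd (IsC0Semigroup.GenAt.unique h1 (hRgen y))
  let Jr : (F × E) →L[ℝ] F := (J ∘ₗ r).mkContinuous
    (|M| * (‖i‖ * ‖R‖ + (|l| * ‖R‖ + 1))) fun y => by
      have h1 : ‖(R y).1‖ ≤ ‖R‖ * ‖y‖ := (norm_fst_le _).trans (R.le_opNorm y)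
      have h2 : ‖(R y).2‖ ≤ ‖R‖ * ‖y‖ := (norm_snd_le _).trans (R.le_opNorm y)
      calc ‖J (r y)‖ ≤ M * (‖i (r y : F)‖ + ‖K (r y)‖) := hM _
        _ ≤ |M| * (‖i (r y : F)‖ + ‖K (r y)‖) := by gcongr; exact le_abs_self M
        _ ≤ |M| * (‖i‖ * (‖R‖ * ‖y‖) + (|l| * (‖R‖ * ‖y‖) + ‖y‖)) := by
            gcongr
            · exact i.le_opNorm_of_le h1
            · rw [hKr]
              refine (norm_sub_le _ _).trans (add_le_add ?_ (norm_snd_le y))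
              rw [norm_smul, Real.norm_eq_abs]
              gcongr
        _ = _ := by ring
  have hJr : ∀ y, Jr y = J (r y) := fun _ => rfl
  classical
  obtain ⟨S, hS, hST⟩ := hT.exists_perturbation_of_intertwining hR
    (C := (-Jr).prod (l • (i ∘L Jr)))
    (B := fun p => (0, if h : p.1 ∈ DK then i (J ⟨p.1, h⟩) else 0)) fun y => by
      have h1 := (hR _ _).1 (hgen 0 (Jr y))
      simp only [map_zero, ZeroMemClass.coe_zero] at h1
      rw [dif_pos (hmem y)]
      refine Eq.trans ?_ (h1.trans (congrArg R ?_))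
      · rfl
      · simp
  have hB : ∀ (u : DK) (v : F), IsC0Semigroup.GenAt S ((u : F), i v) (v, K u + i (J u)) :=
    fun u v => (hST _ _).2 (by simpa [IsC0Semigroup.GenAt] using hgen u v)
  exact ⟨S, hS.zero, hS.add, hS.cont, hB, fun p d h => hmax p _ ((hST p d).1 h)⟩
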